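/- Let n be odd. Then Σ_{π∈Sym(n)} ε(π)·(L_n^SE(π) − L_n^SO(π)) = (−1)^{n(n−1)/2}·n!·(n−1)!·AT(n). -/

import Mathlib

/-- `L` is a Latin square of order `n`: every row and every column is a
bijection of `Fin n` (i.e. contains each symbol exactly once). -/
def IsLatin {n : ℕ} (L : Fin n → Fin n → Fin n) : Prop :=
  (∀ i, Function.Bijective fun j => L i j) ∧ ∀ j, Function.Bijective fun i => L i j

/-- The permutation determined by a bijective function (junk value `1` otherwise). -/
noncomputable def permOf {n : ℕ} (f : Fin n → Fin n) : Equiv.Perm (Fin n) :=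
  if h : Function.Bijective f then Equiv.ofBijective f h else 1

/-- The product of the signs of the rows of `L`. -/
noncomputable def rowSign {n : ℕ} (L : Fin n → Fin n → Fin n) : ℤ :=
  ∏ i, (Equiv.Perm.sign (permOf fun j => L i j) : ℤ)

/-- The product of the signs of the columns of `L`. -/
noncomputable def colSign {n : ℕ} (L : Fin n → Fin n → Fin n) : ℤ :=
  ∏ j, (Equiv.Perm.sign (permOf fun i => L i j) : ℤ)

/-- The sign of a Latin square: row-sign times column-sign. -/
noncomputable def latinSign {n : ℕ} (L : Fin n → Fin n → Fin n) : ℤ :=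
  rowSign L * colSign L

/-- The permutation `α_s` of a Latin square `L`: `α_s i = j` iff `L i j = s`. -/
noncomputable def symPerm {n : ℕ} (L : Fin n → Fin n → Fin n) (s : Fin n) :
    Equiv.Perm (Fin n) :=
  permOf fun i => (permOf fun j => L i j).symm s

/-- The symbol-sign of a Latin square: the product of the signs of the `α_s`. -/
noncomputable def symbolSign {n : ℕ} (L : Fin n → Fin n → Fin n) : ℤ :=
  ∏ s, (Equiv.Perm.sign (symPerm L s) : ℤ)

/-- The number of Latin squares of order `n`. -/
noncomputable def numLatin (n : ℕ) : ℕ :=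
  Nat.card {L : Fin n → Fin n → Fin n // IsLatin L}

/-- The number of even Latin squares of order `n`. -/
noncomputable def numLatinEven (n : ℕ) : ℕ :=
  Nat.card {L : Fin n → Fin n → Fin n // IsLatin L ∧ latinSign L = 1}

/-- The number of odd Latin squares of order `n`. -/
noncomputable def numLatinOdd (n : ℕ) : ℕ :=
  Nat.card {L : Fin n → Fin n → Fin n // IsLatin L ∧ latinSign L = -1}

/-- `L` is normalized: its first row is the identity permutation. -/
def IsNormalized {n : ℕ} (L : Fin n → Fin n → Fin n) : Prop :=
  ∀ j : Fin n, L ⟨0, j.pos⟩ j = j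

/-- `L` is unipotent: all entries on the main diagonal are equal. -/
def IsUnipotent {n : ℕ} (L : Fin n → Fin n → Fin n) : Prop :=
  ∀ i k : Fin n, L i i = L k k

/-- The Alon-Tarsi constant `AT(n) = U_n^E - U_n^O`. -/
noncomputable def AT (n : ℕ) : ℤ :=
  (Nat.card {L : Fin n → Fin n → Fin n //
      IsLatin L ∧ IsNormalized L ∧ IsUnipotent L ∧ latinSign L = 1} : ℤ) -
  (Nat.card {L : Fin n → Fin n → Fin n //
      IsLatin L ∧ IsNormalized L ∧ IsUnipotent L ∧ latinSign L = -1} : ℤ)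

/-- `L` is reduced: first row and first column are the identity. -/
def IsReducedLatin {n : ℕ} (L : Fin n → Fin n → Fin n) : Prop :=
  IsNormalized L ∧ ∀ i : Fin n, L i ⟨0, i.pos⟩ = i

/-- The number of even reduced Latin squares of order `n`. -/
noncomputable def numReducedEven (n : ℕ) : ℕ :=
  Nat.card {L : Fin n → Fin n → Fin n // IsLatin L ∧ IsReducedLatin L ∧ latinSign L = 1}

/-- The number of odd reduced Latin squares of order `n`. -/
noncomputable def numReducedOdd (n : ℕ) : ℕ :=
  Nat.card {L : Fin n → Fin n → Fin n // IsLatin L ∧ IsReducedLatin L ∧ latinSign L = -1}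

/-- `L_n^SE(π)`: Latin squares whose permutation `α₁` (of the first symbol)
is `π` and whose symbol-sign is `+1`. The first symbol is the element of
`Fin n` with value `0`, and `α₁ = π` is expressed by `L i (π i) = first symbol`. -/
noncomputable def numSymEven (n : ℕ) (π : Equiv.Perm (Fin n)) : ℕ :=
  Nat.card {L : Fin n → Fin n → Fin n //
    IsLatin L ∧ (∀ i, (L i (π i)).val = 0) ∧ symbolSign L = 1}

/-- `L_n^SO(π)`: as `numSymEven` but with symbol-sign `-1`. -/
noncomputable def numSymOdd (n : ℕ) (π : Equiv.Perm (Fin n)) : ℕ :=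
  Nat.card {L : Fin n → Fin n → Fin n //
    IsLatin L ∧ (∀ i, (L i (π i)).val = 0) ∧ symbolSign L = -1}

/-- `L_n^CE(π)`: column-even Latin squares with first column `π`. -/
noncomputable def numColEven (n : ℕ) (π : Equiv.Perm (Fin n)) : ℕ :=
  Nat.card {L : Fin n → Fin n → Fin n //
    IsLatin L ∧ (∀ i : Fin n, L i ⟨0, i.pos⟩ = π i) ∧ colSign L = 1}

/-- `L_n^CO(π)`: column-odd Latin squares with first column `π`. -/
noncomputable def numColOdd (n : ℕ) (π : Equiv.Perm (Fin n)) : ℕ :=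
  Nat.card {L : Fin n → Fin n → Fin n //
    IsLatin L ∧ (∀ i : Fin n, L i ⟨0, i.pos⟩ = π i) ∧ colSign L = -1}

/-- `L_n^CE(α, β)`: column-even Latin squares with first row `α` and first column `β`. -/
noncomputable def numColEven₂ (n : ℕ) (α β : Equiv.Perm (Fin n)) : ℕ :=
  Nat.card {L : Fin n → Fin n → Fin n //
    IsLatin L ∧ (∀ j : Fin n, L ⟨0, j.pos⟩ j = α j) ∧
      (∀ i : Fin n, L i ⟨0, i.pos⟩ = β i) ∧ colSign L = 1}

/-- `L_n^CO(α, β)`: column-odd Latin squares with first row `α` and first column `β`. -/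
noncomputable def numColOdd₂ (n : ℕ) (α β : Equiv.Perm (Fin n)) : ℕ :=
  Nat.card {L : Fin n → Fin n → Fin n //
    IsLatin L ∧ (∀ j : Fin n, L ⟨0, j.pos⟩ j = α j) ∧
      (∀ i : Fin n, L i ⟨0, i.pos⟩ = β i) ∧ colSign L = -1}

/-- The `n × n` matrix of indeterminates, over `ℤ`. -/
noncomputable def Xmat (n : ℕ) :
    Matrix (Fin n) (Fin n) (MvPolynomial (Fin n × Fin n) ℤ) :=
  Matrix.of fun i j => MvPolynomial.X (i, j)

/-- The exponent vector of the square-free monomial `∏_{i,j} X i j`. -/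
noncomputable def allOnes (n : ℕ) : (Fin n × Fin n) →₀ ℕ :=
  Finsupp.equivFunOnFinite.symm fun _ => 1

/-- The `(0,1)`-matrix (over `ℤ`) associated to a Boolean matrix. -/
def toInt {n : ℕ} (A : Fin n → Fin n → Bool) : Matrix (Fin n) (Fin n) ℤ :=
  Matrix.of fun i j => if A i j then 1 else 0

/-- `σ₀(A)`: the number of zero entries of a `(0,1)`-matrix. -/
def sigma0 {n : ℕ} (A : Fin n → Fin n → Bool) : ℕ :=
  (Finset.univ.filter fun p : Fin n × Fin n => A p.1 p.2 = false).card

theorem permOf_apply {n : ℕ} {f : Fin n → Fin n} (h : Function.Bijective f) (x : Fin n) :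
    permOf f x = f x := by
  rw [permOf, dif_pos h, Equiv.ofBijective_apply]

theorem sign_prodComm (n : ℕ) :
    Equiv.Perm.sign (Equiv.prodComm (Fin n) (Fin n)) = (-1) ^ (n * (n - 1) / 2) := by
  have hfix : Fintype.card (Function.fixedPoints (Equiv.prodComm (Fin n) (Fin n))) = n := by
    refine (Fintype.card_congr ?_).trans (Fintype.card_fin n)
    exact
      { toFun := fun p => p.1.1
        invFun := fun i => ⟨(i, i), rfl⟩
        left_inv := by
          rintro ⟨⟨i, j⟩, h⟩
          have hij : j = i := congrArg Prod.fst h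
          simp [hij]
        right_inv := fun _ => rfl }
  rw [Equiv.Perm.sign_of_pow_two_eq_one (by ext p <;> simp [pow_two]), hfix,
    Fintype.card_prod, Fintype.card_fin, Nat.mul_sub_one]

namespace IsLatin

variable {n : ℕ} {L : Fin n → Fin n → Fin n}

theorem symPerm_apply_eq_iff (hL : IsLatin L) {s i j : Fin n} :
    symPerm L s i = j ↔ L i j = s := by
  have key : ∀ i, L i ((permOf fun j => L i j).symm s) = s := fun i => by
    have h := permOf_apply (hL.1 i) ((permOf fun j => L i j).symm s)
    rw [Equiv.apply_symm_apply] at h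
    exact h.symm
  have hbij : Function.Bijective fun i => (permOf fun j => L i j).symm s := by
    refine Finite.injective_iff_bijective.mp fun a b hab => ?_
    refine (hL.2 ((permOf fun j => L b j).symm s)).1 ?_
    simp only at hab ⊢
    rw [key b, ← hab, key a]
  rw [symPerm, permOf_apply hbij]
  refine ⟨fun h => h ▸ key i, fun h => (hL.1 i).1 ?_⟩
  simp only [key, h]

theorem apply_symPerm (hL : IsLatin L) (s i : Fin n) : L i (symPerm L s i) = s :=
  hL.symPerm_apply_eq_iff.mp rfl

theorem comp_perm_cols (hL : IsLatin L) (σ : Equiv.Perm (Fin n)) :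
    IsLatin fun i j => L i (σ j) :=
  ⟨fun i => (hL.1 i).comp σ.bijective, fun j => hL.2 (σ j)⟩

theorem perm_symbols_comp (hL : IsLatin L) (τ : Equiv.Perm (Fin n)) :
    IsLatin fun i j => τ (L i j) :=
  ⟨fun i => τ.bijective.comp (hL.1 i), fun j => τ.bijective.comp (hL.2 j)⟩

theorem symbolSign_comp_perm_cols (hL : IsLatin L) (σ : Equiv.Perm (Fin n)) :
    symbolSign (fun i j => L i (σ j)) = (Equiv.Perm.sign σ : ℤ) ^ n * symbolSign L := by
  have h : ∀ s, symPerm (fun i j => L i (σ j)) s = σ⁻¹ * symPerm L s := fun s => by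
    ext1 i
    rw [(hL.comp_perm_cols σ).symPerm_apply_eq_iff]
    simp [hL.apply_symPerm]
  simp [symbolSign, h, Finset.prod_mul_distrib]

theorem symbolSign_perm_symbols_comp (hL : IsLatin L) (τ : Equiv.Perm (Fin n)) :
    symbolSign (fun i j => τ (L i j)) = symbolSign L := by
  have h : ∀ s, symPerm (fun i j => τ (L i j)) (τ s) = symPerm L s := fun s => by
    ext1 i
    rw [(hL.perm_symbols_comp τ).symPerm_apply_eq_iff]
    simp [hL.apply_symPerm]
  rw [symbolSign, ← Equiv.prod_comp τ]
  simp only [h, symbolSign]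

/-- The product of the row-, column- and symbol-signs of a Latin square depends only on its
order. -/
theorem symbolSign_mul_latinSign (hL : IsLatin L) :
    symbolSign L * latinSign L = (-1) ^ (n * (n - 1) / 2) := by
  have hperm : Equiv.prodCongrLeft (fun j => permOf fun i => L i j) =
      Equiv.prodComm (Fin n) (Fin n) * Equiv.prodCongrLeft (symPerm L) *
        Equiv.prodCongrRight (fun i => permOf fun j => L i j) := by
    ext1 ⟨i, j⟩
    have h : symPerm L (L i j) i = j := hL.symPerm_apply_eq_iff.mpr rfl
    simp [permOf_apply (hL.1 i), permOf_apply (hL.2 j), h]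
  have hsign := congrArg (fun σ => (Equiv.Perm.sign σ : ℤ)) hperm
  simp only [Equiv.Perm.sign_mul, Equiv.Perm.sign_prodCongrLeft, sign_prodComm,
    Equiv.Perm.sign_prodCongrRight, Units.val_mul, Units.coe_prod, Units.val_pow_eq_pow_val,
    Units.val_neg, Units.val_one] at hsign
  have hsq : ∀ σ : Fin n → Equiv.Perm (Fin n),
      (∏ k, (Equiv.Perm.sign (σ k) : ℤ)) * ∏ k, (Equiv.Perm.sign (σ k) : ℤ) = 1 := fun σ => by
    rw [← Finset.prod_mul_distrib]
    simp
  rw [latinSign, rowSign, colSign, symbolSign, hsign]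
  linear_combination (-1) ^ (n * (n - 1) / 2) *
    ((∏ i, (Equiv.Perm.sign (permOf fun j => L i j) : ℤ)) *
      (∏ i, (Equiv.Perm.sign (permOf fun j => L i j) : ℤ)) * hsq (symPerm L) +
        hsq fun i => permOf fun j => L i j)

end IsLatin

theorem symbolSign_eq_one_or {n : ℕ} (L : Fin n → Fin n → Fin n) :
    symbolSign L = 1 ∨ symbolSign L = -1 := by
  have h := Int.units_eq_one_or (∏ s, Equiv.Perm.sign (symPerm L s))
  rw [symbolSign, ← Units.coe_prod]
  rcases h with h | h <;> simp [h]

theorem IsLatin.latinSign_eq {n : ℕ} {L : Fin n → Fin n → Fin n} (hL : IsLatin L) :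
    latinSign L = (-1) ^ (n * (n - 1) / 2) * symbolSign L := by
  rcases symbolSign_eq_one_or L with h | h <;>
  · have := hL.symbolSign_mul_latinSign
    rw [h] at this ⊢
    linarith

theorem natCard_sub_natCard {α : Type*} [Fintype α] (p : α → Prop) [DecidablePred p] (f : α → ℤ)
    (hf : ∀ a, p a → f a = 1 ∨ f a = -1) :
    (Nat.card {a // p a ∧ f a = 1} : ℤ) - Nat.card {a // p a ∧ f a = -1} =
      ∑ a with p a, f a := by
  simp only [Nat.card_eq_fintype_card, Fintype.card_subtype, Finset.card_filter, Nat.cast_sum,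
    Finset.sum_filter, ← Finset.sum_sub_distrib]
  refine Finset.sum_congr rfl fun a _ => ?_
  by_cases hp : p a
  · rcases hf a hp with h | h <;> simp [hp, h]
  · simp [hp]

open Classical in
theorem numSymEven_sub_numSymOdd {n : ℕ} (π : Equiv.Perm (Fin n)) :
    (numSymEven n π : ℤ) - numSymOdd n π =
      ∑ L with IsLatin L ∧ ∀ i, (L i (π i)).val = 0, symbolSign L := by
  rw [← natCard_sub_natCard _ _ fun L _ => symbolSign_eq_one_or L]
  simp only [numSymEven, numSymOdd, and_assoc]

open Classical in
theorem AT_eq_sum (n : ℕ) :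
    AT n = (-1) ^ (n * (n - 1) / 2) *
      ∑ L : Fin n → Fin n → Fin n with IsLatin L ∧ IsNormalized L ∧ IsUnipotent L,
        symbolSign L := by
  have hsum : AT n = ∑ L : Fin n → Fin n → Fin n with IsLatin L ∧ IsNormalized L ∧ IsUnipotent L,
      latinSign L := by
    rw [← natCard_sub_natCard]
    · simp only [AT, and_assoc]
    · rintro L ⟨hL, -⟩
      rw [hL.latinSign_eq]
      rcases symbolSign_eq_one_or L with h | h <;>
        rcases neg_one_pow_eq_or ℤ (n * (n - 1) / 2) with h' | h' <;> simp [h, h']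
  rw [hsum, Finset.mul_sum]
  exact Finset.sum_congr rfl fun L hL => (Finset.mem_filter.mp hL).2.1.latinSign_eq

/-- Permuting the columns moves the positions of the first symbol onto the main diagonal. -/
theorem sign_mul_numSymEven_sub_numSymOdd {n : ℕ} (hn : Odd n) (π : Equiv.Perm (Fin n)) :
    (Equiv.Perm.sign π : ℤ) * ((numSymEven n π : ℤ) - numSymOdd n π) =
      (numSymEven n 1 : ℤ) - numSymOdd n 1 := by
  classical
  rw [numSymEven_sub_numSymOdd, numSymEven_sub_numSymOdd, Finset.mul_sum]
  refine Finset.sum_bij' (fun L _ i j => L i (π j)) (fun L _ i j => L i (π⁻¹ j)) ?_ ?_ ?_ ?_ ?_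
  · intro L hL
    obtain ⟨hL, h0⟩ := (Finset.mem_filter.mp hL).2
    exact Finset.mem_filter.mpr ⟨Finset.mem_univ _, hL.comp_perm_cols π, h0⟩
  · intro L hL
    obtain ⟨hL, h0⟩ := (Finset.mem_filter.mp hL).2
    exact Finset.mem_filter.mpr ⟨Finset.mem_univ _, hL.comp_perm_cols π⁻¹,
      fun i => by simpa using h0 i⟩
  · intro L _
    simp
  · intro L _
    simp
  · intro L hL
    rw [(Finset.mem_filter.mp hL).2.1.symbolSign_comp_perm_cols]
    rcases Int.units_eq_one_or (Equiv.Perm.sign π) with h | h <;> simp [h, hn.neg_one_pow]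

theorem card_perm_fixing_zero (m : ℕ) :
    Fintype.card {τ : Equiv.Perm (Fin (m + 1)) // τ 0 = 0} = m.factorial := by
  have hcard : Fintype.card (Equiv.Perm (Fin m)) = m.factorial := by
    rw [Fintype.card_perm, Fintype.card_fin]
  rw [← hcard]
  refine (Fintype.card_congr
    { toFun := fun e => ⟨Equiv.Perm.decomposeFin.symm (0, e),
        Equiv.Perm.decomposeFin_symm_apply_zero 0 e⟩
      invFun := fun τ => (Equiv.Perm.decomposeFin τ.1).2
      left_inv := fun e => by simp
      right_inv := by
        rintro ⟨τ, hτ⟩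
        obtain ⟨⟨p, e⟩, rfl⟩ := Equiv.Perm.decomposeFin.symm.surjective τ
        rw [Equiv.Perm.decomposeFin_symm_apply_zero] at hτ
        simp [hτ] }).symm

/-- Relabelling the symbols so that the first row becomes the identity. -/
theorem numSymEven_one_sub_numSymOdd_one (m : ℕ) :
    (numSymEven (m + 1) 1 : ℤ) - numSymOdd (m + 1) 1 =
      (-1) ^ ((m + 1) * m / 2) * m.factorial * AT (m + 1) := by
  classical
  rw [numSymEven_sub_numSymOdd, AT_eq_sum, Nat.add_sub_cancel]
  have hsq : ((-1 : ℤ) ^ ((m + 1) * m / 2)) * (-1) ^ ((m + 1) * m / 2) = 1 := by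
    rw [← mul_pow]; simp
  suffices h : ∑ L : Fin (m + 1) → Fin (m + 1) → Fin (m + 1) with
      IsLatin L ∧ ∀ i, (L i ((1 : Equiv.Perm (Fin (m + 1))) i)).val = 0, symbolSign L =
      ∑ _τ : {τ : Equiv.Perm (Fin (m + 1)) // τ 0 = 0},
        ∑ L : Fin (m + 1) → Fin (m + 1) → Fin (m + 1) with
          IsLatin L ∧ IsNormalized L ∧ IsUnipotent L, symbolSign L by
    rw [h, Finset.sum_const, Finset.card_univ, card_perm_fixing_zero, nsmul_eq_mul]
    linear_combination -(m.factorial : ℤ) * (∑ L : Fin (m + 1) → Fin (m + 1) → Fin (m + 1) with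
          IsLatin L ∧ IsNormalized L ∧ IsUnipotent L, symbolSign L) * hsq
  rw [← Finset.sum_product']
  symm
  have hrow : ∀ L : Fin (m + 1) → Fin (m + 1) → Fin (m + 1), IsLatin L → ∀ j,
      (permOf fun j => L 0 j) j = L 0 j := fun L hL j => permOf_apply (hL.1 0) j
  have hdiag : ∀ L : Fin (m + 1) → Fin (m + 1) → Fin (m + 1), IsNormalized L → IsUnipotent L →
      ∀ i, L i i = 0 := fun L hN hU i => (hU i 0).trans (hN 0)
  refine Finset.sum_bij (fun x _ i j => x.1.1 (x.2 i j)) ?_ ?_ ?_ ?_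
  · rintro ⟨⟨τ, hτ⟩, L⟩ hx
    obtain ⟨hL, hN, hU⟩ := (Finset.mem_filter.mp (Finset.mem_product.mp hx).2).2
    refine Finset.mem_filter.mpr ⟨Finset.mem_univ _, hL.perm_symbols_comp τ, fun i => ?_⟩
    simp [hdiag L hN hU, hτ]
  · rintro ⟨⟨τ, hτ⟩, L⟩ hx ⟨⟨τ', hτ'⟩, L'⟩ hx' h
    obtain ⟨-, hN, -⟩ := (Finset.mem_filter.mp (Finset.mem_product.mp hx).2).2
    obtain ⟨-, hN', -⟩ := (Finset.mem_filter.mp (Finset.mem_product.mp hx').2).2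
    have hij : ∀ i j, τ (L i j) = τ' (L' i j) := fun i j => congrFun (congrFun h i) j
    obtain rfl : τ = τ' := by
      ext1 j
      have h0 := hij 0 j
      rwa [show L 0 j = j from hN j, show L' 0 j = j from hN' j] at h0
    obtain rfl : L = L' := by
      ext1 i
      ext1 j
      exact τ.injective (hij i j)
    rfl
  · intro L hL
    obtain ⟨hL, h0⟩ := (Finset.mem_filter.mp hL).2
    have h0' : ∀ i, L i i = 0 := fun i => Fin.ext (h0 i)
    set τ := permOf fun j => L 0 j
    have hτ0 : τ 0 = 0 := (hrow L hL 0).trans (h0' 0)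
    refine ⟨(⟨τ, hτ0⟩, fun i j => τ⁻¹ (L i j)), ?_, ?_⟩
    · refine Finset.mem_product.mpr ⟨Finset.mem_univ _, Finset.mem_filter.mpr
        ⟨Finset.mem_univ _, hL.perm_symbols_comp τ⁻¹, fun j => ?_, fun i k => ?_⟩⟩
      · exact Equiv.Perm.inv_eq_iff_eq.mpr (hrow L hL j).symm
      · simp only [h0']
    · simp
  · rintro ⟨⟨τ, hτ⟩, L⟩ hx
    obtain ⟨hL, -⟩ := (Finset.mem_filter.mp (Finset.mem_product.mp hx).2).2
    exact (hL.symbolSign_perm_symbols_comp τ).symm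

/-- For odd `n`,
`∑_π ε(π)(L_n^SE(π) - L_n^SO(π)) = (-1)^{n(n-1)/2} n! (n-1)! AT(n)`. -/
theorem sum_sign_symDiff_eq (n : ℕ) (hn : Odd n) :
    ∑ π : Equiv.Perm (Fin n),
        (Equiv.Perm.sign π : ℤ) * ((numSymEven n π : ℤ) - numSymOdd n π)
      = (-1) ^ (n * (n - 1) / 2) * n.factorial * (n - 1).factorial * AT n := by
  obtain ⟨m, rfl⟩ : ∃ m, n = m + 1 := ⟨n - 1, by have := hn.pos; omega⟩
  rw [Finset.sum_congr rfl fun π _ => sign_mul_numSymEven_sub_numSymOdd hn π, Finset.sum_const,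
    Finset.card_univ, Fintype.card_perm, Fintype.card_fin, numSymEven_one_sub_numSymOdd_one,
    nsmul_eq_mul, Nat.add_sub_cancel]
  ring
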